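/- Corollary of Lemma 3 for unimodal projections: let X = ⟨X1, X2⟩ be a pair of random variables with values in finite sets, Y a finitely-valued random variable, and let R, S, U1, U2 be nonnegative reals satisfying the PID consistency equations I(⟨X1,X2⟩ : Y) = R + S + U1 + U2, I(X1 : Y) = R + U1, I(X2 : Y) = R + U2. Fix i ∈ {1,2} and let tᵢ be the projection X ↦ Xᵢ (masking the other modality). If f* is a function with I(f* ∘ X : f* ∘ (tᵢ ∘ X)) = I(X : tᵢ ∘ X), then the representation Zᵢ = f* ∘ Xᵢ satisfies I(Zᵢ : Y) = I(Xᵢ : Y) = R + Uᵢ. -/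

import Mathlib

open MeasureTheory ProbabilityTheory Real

/-- Shannon entropy of a finitely-valued random variable `X` under `μ`. -/
noncomputable def shEntropy {Ω α : Type*} [MeasurableSpace Ω] [Fintype α]
    (μ : Measure Ω) (X : Ω → α) : ℝ :=
  -∑ a : α, (μ (X ⁻¹' {a})).toReal * Real.log (μ (X ⁻¹' {a})).toReal

/-- Shannon mutual information `I(X : Y) = H(X) + H(Y) - H(⟨X,Y⟩)`. -/
noncomputable def mutInfo {Ω α β : Type*} [MeasurableSpace Ω] [Fintype α] [Fintype β]
    (μ : Measure Ω) (X : Ω → α) (Y : Ω → β) : ℝ :=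
  shEntropy μ X + shEntropy μ Y - shEntropy μ (fun ω => (X ω, Y ω))

/-- Conditional mutual information
`I(X : Y | Z) = H(⟨X,Z⟩) + H(⟨Y,Z⟩) - H(Z) - H(⟨X,Y,Z⟩)`. -/
noncomputable def condMutInfo {Ω α β γ : Type*} [MeasurableSpace Ω]
    [Fintype α] [Fintype β] [Fintype γ]
    (μ : Measure Ω) (X : Ω → α) (Y : Ω → β) (Z : Ω → γ) : ℝ :=
  shEntropy μ (fun ω => (X ω, Z ω)) + shEntropy μ (fun ω => (Y ω, Z ω))
    - shEntropy μ Z - shEntropy μ (fun ω => (X ω, Y ω, Z ω))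

/-- Collapsing values of `X` through `g`, the entropy of `g ∘ X` as a sum over the values of `X`. -/
lemma shEntropy_comp {Ω α β : Type*} [MeasurableSpace Ω] [Fintype α] [MeasurableSpace α]
    [MeasurableSingletonClass α] [Fintype β] (μ : Measure Ω) [IsProbabilityMeasure μ]
    {X : Ω → α} (hX : Measurable X) (g : α → β) :
    shEntropy μ (g ∘ X) =
      -∑ a, μ.real (X ⁻¹' {a}) * log (μ.real ((g ∘ X) ⁻¹' {g a})) := by
  classical
  have hfiber (b : β) : μ.real ((g ∘ X) ⁻¹' {b}) =
      ∑ a with g a = b, μ.real (X ⁻¹' {a}) := by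
    rw [sum_measureReal_preimage_singleton _ fun a _ =>
      hX (measurableSet_singleton a)]
    congr 1
    ext ω
    simp
  unfold shEntropy
  congr 1
  rw [← Finset.sum_fiberwise (s := Finset.univ) (g := g)]
  refine Finset.sum_congr rfl fun b _ => ?_
  change μ.real _ * log (μ.real _) = _
  nth_rewrite 1 [hfiber b]
  rw [Finset.sum_mul]
  refine Finset.sum_congr rfl fun a ha => ?_
  rw [(Finset.mem_filter.mp ha).2]

lemma measureReal_preimage_singleton_le_comp {Ω α β : Type*} [MeasurableSpace Ω]
    (μ : Measure Ω) [IsProbabilityMeasure μ] (X : Ω → α) (g : α → β) (a : α) :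
    μ.real (X ⁻¹' {a}) ≤ μ.real ((g ∘ X) ⁻¹' {g a}) :=
  measureReal_mono fun ω hω => congrArg g hω

lemma mul_log_le_mul_log_of_le {p q : ℝ} (hp : 0 ≤ p) (hpq : p ≤ q) :
    p * log p ≤ p * log q := by
  rcases hp.eq_or_lt with rfl | hp
  · simp
  · gcongr

lemma shEntropy_comp_le {Ω α β : Type*} [MeasurableSpace Ω] [Fintype α] [MeasurableSpace α]
    [MeasurableSingletonClass α] [Fintype β] (μ : Measure Ω) [IsProbabilityMeasure μ]
    {X : Ω → α} (hX : Measurable X) (g : α → β) :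
    shEntropy μ (g ∘ X) ≤ shEntropy μ X := by
  rw [shEntropy_comp μ hX]
  exact neg_le_neg <| Finset.sum_le_sum fun a _ =>
    mul_log_le_mul_log_of_le measureReal_nonneg (measureReal_preimage_singleton_le_comp μ X g a)

/-- Applying `g` loses no entropy iff `g` is almost surely injective on the values of `X`. -/
lemma shEntropy_comp_eq_iff {Ω α β : Type*} [MeasurableSpace Ω] [Fintype α] [MeasurableSpace α]
    [MeasurableSingletonClass α] [Fintype β] (μ : Measure Ω) [IsProbabilityMeasure μ]
    {X : Ω → α} (hX : Measurable X) (g : α → β) :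
    shEntropy μ (g ∘ X) = shEntropy μ X ↔
      ∀ a, μ.real (X ⁻¹' {a}) = 0 ∨ μ.real ((g ∘ X) ⁻¹' {g a}) = μ.real (X ⁻¹' {a}) := by
  have hle := measureReal_preimage_singleton_le_comp μ X g
  rw [shEntropy_comp μ hX, shEntropy, neg_inj, eq_comm]
  change ∑ a, μ.real (X ⁻¹' {a}) * log (μ.real (X ⁻¹' {a})) = _ ↔ _
  rw [Finset.sum_eq_sum_iff_of_le fun a _ =>
    mul_log_le_mul_log_of_le measureReal_nonneg (hle a)]
  refine ⟨fun h a => ?_, fun h a _ => ?_⟩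
  · by_cases h0 : μ.real (X ⁻¹' {a}) = 0
    · exact .inl h0
    · have hpos : 0 < μ.real (X ⁻¹' {a}) := lt_of_le_of_ne measureReal_nonneg (Ne.symm h0)
      exact .inr (log_injOn_pos (hpos.trans_le (hle a)) hpos
        (mul_left_cancel₀ h0 (h a (Finset.mem_univ a))).symm)
  · rcases h a with h | h <;> simp [h]

lemma shEntropy_comp_of_injective {Ω α β : Type*} [MeasurableSpace Ω] [Fintype α]
    [MeasurableSpace α] [MeasurableSingletonClass α] [Fintype β] (μ : Measure Ω)
    [IsProbabilityMeasure μ] {X : Ω → α} (hX : Measurable X) {g : α → β}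
    (hg : Function.Injective g) :
    shEntropy μ (g ∘ X) = shEntropy μ X := by
  refine (shEntropy_comp_eq_iff μ hX g).mpr fun a => .inr ?_
  congr 1
  ext ω
  simp [hg.eq_iff]

/-- If applying `g` to `X` loses no entropy, it loses no information about any `Y`. -/
lemma mutInfo_comp_of_shEntropy_comp_eq {Ω α β γ : Type*} [MeasurableSpace Ω]
    [Fintype α] [MeasurableSpace α] [MeasurableSingletonClass α] [Fintype β]
    [Fintype γ] [MeasurableSpace γ] [MeasurableSingletonClass γ]
    (μ : Measure Ω) [IsProbabilityMeasure μ] {X : Ω → α} {Y : Ω → γ}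
    (hX : Measurable X) (hY : Measurable Y) (g : α → β)
    (h : shEntropy μ (g ∘ X) = shEntropy μ X) :
    mutInfo μ (g ∘ X) Y = mutInfo μ X Y := by
  have hpair : shEntropy μ (Prod.map g id ∘ fun ω => (X ω, Y ω)) =
      shEntropy μ fun ω => (X ω, Y ω) := by
    refine (shEntropy_comp_eq_iff μ (hX.prodMk hY) _).mpr fun ⟨a, c⟩ => ?_
    have hXY : (fun ω => (X ω, Y ω)) ⁻¹' {(a, c)} = X ⁻¹' {a} ∩ Y ⁻¹' {c} := by
      ext ω; simp
    have hgXY : (Prod.map g id ∘ fun ω => (X ω, Y ω)) ⁻¹' {Prod.map g id (a, c)} =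
        (g ∘ X) ⁻¹' {g a} ∩ Y ⁻¹' {c} := by
      ext ω; simp
    rw [hXY, hgXY]
    rcases (shEntropy_comp_eq_iff μ hX g).mp h a with h0 | h1
    · exact .inl (measureReal_mono_null Set.inter_subset_left h0)
    · right
      have hae : X ⁻¹' {a} =ᵐ[μ] (g ∘ X) ⁻¹' {g a} :=
        ae_eq_of_subset_of_measure_ge (fun ω hω => congrArg g hω)
          ((measureReal_eq_measureReal_iff).mp h1).le
          (hX (measurableSet_singleton a)).nullMeasurableSet (measure_ne_top μ _)
      exact measureReal_congr (hae.symm.inter (ae_eq_refl _))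
  have hpair' : shEntropy μ (fun ω => ((g ∘ X) ω, Y ω)) = shEntropy μ fun ω => (X ω, Y ω) :=
    hpair
  rw [mutInfo, mutInfo, h, hpair']

/-- An encoder preserving the information between `X` and its view `t ∘ X` preserves the
information between that view and any `Y`. -/
lemma mutInfo_encoder_comp {Ω α β γ : Type*} [MeasurableSpace Ω]
    [Fintype α] [MeasurableSpace α] [MeasurableSingletonClass α]
    [Fintype β] [MeasurableSpace β] [MeasurableSingletonClass β]
    [Fintype γ] [MeasurableSpace γ] [MeasurableSingletonClass γ]
    (μ : Measure Ω) [IsProbabilityMeasure μ] {X : Ω → α} {Y : Ω → γ}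
    (hX : Measurable X) (hY : Measurable Y) (t : α → α) (f : α → β)
    (h : mutInfo μ (f ∘ X) (f ∘ (t ∘ X)) = mutInfo μ X (t ∘ X)) :
    mutInfo μ (f ∘ (t ∘ X)) Y = mutInfo μ (t ∘ X) Y := by
  have ht : Measurable (t ∘ X) := (measurable_of_finite t).comp hX
  have hview : shEntropy μ (fun ω => (X ω, (t ∘ X) ω)) = shEntropy μ X :=
    shEntropy_comp_of_injective μ hX (g := fun a => (a, t a))
      fun _ _ hab => congrArg Prod.fst hab
  have hfst : shEntropy μ (f ∘ X) ≤ shEntropy μ fun ω => ((f ∘ X) ω, (f ∘ (t ∘ X)) ω) :=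
    shEntropy_comp_le μ (((measurable_of_finite f).comp hX).prodMk
      ((measurable_of_finite f).comp ht)) Prod.fst
  have hle := shEntropy_comp_le μ ht f
  simp only [mutInfo] at h
  exact mutInfo_comp_of_shEntropy_comp_eq μ ht hY f (by linarith)

/-- Corollary of Lemma 3 for unimodal projections: for the multimodal input
`X = ⟨X1, X2⟩` and the projection `tᵢ` masking the other modality (with mask tokens
`m1, m2`), any optimal encoder `fᵢ` for the projected view yields a representation
`Zᵢ = fᵢ ∘ Xᵢ` with `I(Zᵢ : Y) = I(Xᵢ : Y) = R + Uᵢ`, for each `i ∈ {1,2}`. -/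
theorem unimodal_projection_representation
    {Ω α1 α2 γ β : Type*} [MeasurableSpace Ω]
    [Fintype α1] [MeasurableSpace α1] [MeasurableSingletonClass α1]
    [Fintype α2] [MeasurableSpace α2] [MeasurableSingletonClass α2]
    [Fintype γ] [MeasurableSpace γ] [MeasurableSingletonClass γ]
    [Fintype β] [MeasurableSpace β] [MeasurableSingletonClass β]
    (μ : Measure Ω) [IsProbabilityMeasure μ]
    (X1 : Ω → α1) (X2 : Ω → α2) (Y : Ω → γ)
    (hX1 : Measurable X1) (hX2 : Measurable X2) (hY : Measurable Y)
    (R S U1 U2 : ℝ) (hR : 0 ≤ R) (hS : 0 ≤ S) (hU1 : 0 ≤ U1) (hU2 : 0 ≤ U2)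
    (hPID : mutInfo μ (fun ω => (X1 ω, X2 ω)) Y = R + S + U1 + U2)
    (h1 : mutInfo μ X1 Y = R + U1)
    (h2 : mutInfo μ X2 Y = R + U2)
    (m1 : α1) (m2 : α2)
    (f1 f2 : α1 × α2 → β) :
    ((mutInfo μ (f1 ∘ (fun ω => (X1 ω, X2 ω))) (f1 ∘ (fun ω => (X1 ω, m2))) =
        mutInfo μ (fun ω => (X1 ω, X2 ω)) (fun ω => (X1 ω, m2))) →
      mutInfo μ (f1 ∘ (fun ω => (X1 ω, m2))) Y = mutInfo μ X1 Y ∧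
        mutInfo μ X1 Y = R + U1) ∧
    ((mutInfo μ (f2 ∘ (fun ω => (X1 ω, X2 ω))) (f2 ∘ (fun ω => (m1, X2 ω))) =
        mutInfo μ (fun ω => (X1 ω, X2 ω)) (fun ω => (m1, X2 ω))) →
      mutInfo μ (f2 ∘ (fun ω => (m1, X2 ω))) Y = mutInfo μ X2 Y ∧
        mutInfo μ X2 Y = R + U2) := by
  have hX : Measurable fun ω => (X1 ω, X2 ω) := hX1.prodMk hX2
  refine ⟨fun h => ⟨?_, h1⟩, fun h => ⟨?_, h2⟩⟩
  · exact (mutInfo_encoder_comp μ hX hY (fun x => (x.1, m2)) f1 h).trans <|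
      mutInfo_comp_of_shEntropy_comp_eq μ hX1 hY (fun a => (a, m2)) <|
        shEntropy_comp_of_injective μ hX1 (Prod.mk_left_injective m2)
  · exact (mutInfo_encoder_comp μ hX hY (fun x => (m1, x.2)) f2 h).trans <|
      mutInfo_comp_of_shEntropy_comp_eq μ hX2 hY (fun a => (m1, a)) <|
        shEntropy_comp_of_injective μ hX2 (Prod.mk_right_injective m1)
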